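/- arXiv:1210.8284 — 3 statements merged into one kernel-verified Lean document; each statement's English description precedes it below -/
import Mathlib

section
/- Let d ≥ 2, p ∈ [2,∞), and let A ∈ ℝ^{n_1×⋯×n_d} be a non-zero order-d tensor with symmetrization sym(A) ∈ ℝ^{N^d}, N = n_1+⋯+n_d. If z̄ ∈ ℝ^N attains the maximum of f_{sym(A)}(z) over { z ∈ ℝ^N : ‖z‖_p ≤ d^{1/p} }, then each block of z̄ satisfies ‖z̄^{(i)}‖_p = 1 for i = 1,…,d. -/
open scoped ENNReal

/-- The `L_p` norm of a vector `x ∈ ℝ^ι`, for `p ∈ [1,∞]` (for `p = ∞`, the max norm). -/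
noncomputable def lpNorm {ι : Type*} [Fintype ι] (p : ℝ≥0∞) (x : ι → ℝ) : ℝ :=
  if p = ∞ then ⨆ i, |x i| else (∑ i, |x i| ^ p.toReal) ^ (1 / p.toReal)

/-- The symmetrization `sym(A)` of an order-`d` tensor `A ∈ ℝ^{n_1 × ⋯ × n_d}`. -/
noncomputable def symTensor {d : ℕ} {n : Fin d → ℕ}
    (A : ((j : Fin d) → Fin (n j)) → ℝ)
    (k : Fin d → (Σ j : Fin d, Fin (n j))) : ℝ :=
  ∑ σ : Equiv.Perm (Fin d),
    if h : ∀ t, (k (σ t)).1 = t then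
      A (fun t => Fin.cast (congrArg n (h t)) (k (σ t)).2)
    else 0

/-- The multilinear form of `A` evaluated at the blocks of `z`. -/
noncomputable def blockForm {d : ℕ} {n : Fin d → ℕ}
    (A : ((j : Fin d) → Fin (n j)) → ℝ) (z : (Σ j : Fin d, Fin (n j)) → ℝ) : ℝ :=
  ∑ i, A i * ∏ t, z ⟨t, i t⟩

theorem sum_dite_fst_eq_blockForm {d : ℕ} {n : Fin d → ℕ}
    (A : ((j : Fin d) → Fin (n j)) → ℝ) (z : (Σ j : Fin d, Fin (n j)) → ℝ) :
    (∑ k : Fin d → (Σ j : Fin d, Fin (n j)),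
      (if h : ∀ t, (k t).1 = t then
        A (fun t => Fin.cast (congrArg n (h t)) (k t).2) else 0) * ∏ s, z (k s)) =
      blockForm A z := by
  symm
  refine Finset.sum_of_injOn (fun i t => ⟨t, i t⟩) ?_ (by simp) ?_ ?_
  · intro i _ j _ hij
    funext t
    simpa using congrFun hij t
  · intro k _ hk
    rw [dif_neg, zero_mul]
    intro h
    refine hk ⟨fun t => Fin.cast (congrArg n (h t)) (k t).2, by simp, ?_⟩
    have key (x : Σ j : Fin d, Fin (n j)) (t : Fin d) (hx : x.1 = t) :
        (⟨t, Fin.cast (congrArg n hx) x.2⟩ : Σ j : Fin d, Fin (n j)) = x := by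
      subst hx
      rfl
    funext t
    exact key (k t) t (h t)
  · intro i _
    simp

theorem sum_symTensor_mul_prod {d : ℕ} {n : Fin d → ℕ}
    (A : ((j : Fin d) → Fin (n j)) → ℝ) (z : (Σ j : Fin d, Fin (n j)) → ℝ) :
    (∑ k : Fin d → (Σ j : Fin d, Fin (n j)), symTensor A k * ∏ s, z (k s)) =
      (d.factorial : ℝ) * blockForm A z := by
  simp only [symTensor, Finset.sum_mul]
  rw [Finset.sum_comm]
  have key (σ : Equiv.Perm (Fin d)) :
      (∑ k : Fin d → (Σ j : Fin d, Fin (n j)),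
        (if h : ∀ t, (k (σ t)).1 = t then
          A (fun t => Fin.cast (congrArg n (h t)) (k (σ t)).2) else 0) * ∏ s, z (k s)) =
        blockForm A z := by
    rw [← sum_dite_fst_eq_blockForm]
    refine Fintype.sum_equiv (Equiv.arrowCongr σ.symm (Equiv.refl _)) _ _ fun k => ?_
    congr 1
    exact (Equiv.prod_comp σ fun s => z (k s)).symm
  rw [Finset.sum_congr rfl fun σ _ => key σ]
  simp [Fintype.card_perm]

/-- Scaling each block scales the multilinear form by the product of the factors. -/
theorem blockForm_smul {d : ℕ} {n : Fin d → ℕ}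
    (A : ((j : Fin d) → Fin (n j)) → ℝ) (z : (Σ j : Fin d, Fin (n j)) → ℝ) (c : Fin d → ℝ) :
    blockForm A (fun x => c x.1 * z x) = (∏ t, c t) * blockForm A z := by
  simp only [blockForm, Finset.mul_sum, Finset.prod_mul_distrib]
  exact Finset.sum_congr rfl fun i _ => by ring

/-- A block that vanishes makes the multilinear form vanish. -/
theorem blockForm_eq_zero_of_block {d : ℕ} {n : Fin d → ℕ}
    (A : ((j : Fin d) → Fin (n j)) → ℝ) (z : (Σ j : Fin d, Fin (n j)) → ℝ) (t : Fin d)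
    (h : ∀ m, z ⟨t, m⟩ = 0) : blockForm A z = 0 :=
  Finset.sum_eq_zero fun i _ => by
    rw [Finset.prod_eq_zero (Finset.mem_univ t) (h (i t)), mul_zero]

/-- A non-zero tensor has a positive value at some vector all of whose blocks are signed
standard basis vectors. -/
theorem exists_blockForm_pos {d : ℕ} (hd : 0 < d) {n : Fin d → ℕ}
    {A : ((j : Fin d) → Fin (n j)) → ℝ} (hA : A ≠ 0) {q : ℝ} (hq : 0 < q) :
    ∃ z : (Σ j : Fin d, Fin (n j)) → ℝ,
      0 < blockForm A z ∧ ∀ t, ∑ m, |z ⟨t, m⟩| ^ q = 1 := by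
  obtain ⟨i, hi⟩ : ∃ i, A i ≠ 0 := Function.ne_iff.mp hA
  let e : (Σ j : Fin d, Fin (n j)) → ℝ := fun x => if x.2 = i x.1 then 1 else 0
  have he : blockForm A e = A i := by
    rw [blockForm, Finset.sum_eq_single i]
    · simp [e]
    · intro j _ hj
      obtain ⟨t, ht⟩ := Function.ne_iff.mp hj
      rw [Finset.prod_eq_zero (Finset.mem_univ t), mul_zero]
      simp [e, ht]
    · simp
  let c : Fin d → ℝ := fun t => if t = ⟨0, hd⟩ then SignType.sign (A i) else 1
  have hc (t : Fin d) : |c t| = 1 := by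
    rcases hi.lt_or_gt with h | h <;> by_cases ht : t = ⟨0, hd⟩ <;> simp [c, ht, h]
  refine ⟨fun x => c x.1 * e x, ?_, fun t => ?_⟩
  · rw [blockForm_smul, he]
    simpa [c] using hi
  · rw [Finset.sum_eq_single (i t)]
    · simp [hc, e]
    · intro m _ hm
      simp [e, hm, Real.zero_rpow hq.ne']
    · simp

theorem eq_one_of_sum_le_card_of_one_le_prod {ι : Type*} [Fintype ι] {S : ι → ℝ}
    (hpos : ∀ i, 0 < S i) (hsum : ∑ i, S i ≤ Fintype.card ι) (hprod : 1 ≤ ∏ i, S i) (i : ι) :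
    S i = 1 := by
  have hlog : 0 ≤ ∑ i, Real.log (S i) := by
    rw [← Real.log_prod fun i _ => (hpos i).ne']
    exact Real.log_nonneg hprod
  by_contra hne
  have : ∑ i, Real.log (S i) < ∑ i, (S i - 1) :=
    Finset.sum_lt_sum (fun j _ => Real.log_le_sub_one_of_pos (hpos j))
      ⟨i, Finset.mem_univ i, Real.log_lt_sub_one_of_pos (hpos i) hne⟩
  simp only [Finset.sum_sub_distrib, Finset.sum_const, Finset.card_univ, nsmul_eq_mul,
    mul_one] at this
  linarith

/-- Feasibility in `L_p` norm, in terms of the blockwise sums of `p`-th powers. -/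
theorem lpNorm_sigma_le_iff {d : ℕ} {n : Fin d → ℕ} {p : ℝ≥0∞} (hp : 0 < p.toReal)
    (hptop : p ≠ ∞) (z : (Σ j : Fin d, Fin (n j)) → ℝ) :
    lpNorm p z ≤ (d : ℝ) ^ (1 / p.toReal) ↔ ∑ t, ∑ m, |z ⟨t, m⟩| ^ p.toReal ≤ d := by
  rw [lpNorm, if_neg hptop, Fintype.sum_sigma,
    Real.rpow_le_rpow_iff (by positivity) (by positivity) (by positivity)]

/-- For `d ≥ 2`, `p ∈ [2,∞)` and a non-zero order-`d` tensor `A`: if `z̄` maximizes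
`f_{sym(A)}` over `{ z : ‖z‖_p ≤ d^{1/p} }`, then every block of `z̄` satisfies
`‖z̄^{(i)}‖_p = 1`. -/
theorem maximizer_blocks_have_unit_norm (d : ℕ) (hd : 2 ≤ d)
    (p : ℝ≥0∞) (hp : 2 ≤ p) (hptop : p ≠ ∞) (n : Fin d → ℕ)
    (A : ((j : Fin d) → Fin (n j)) → ℝ) (hA : A ≠ 0)
    (zbar : (Σ j : Fin d, Fin (n j)) → ℝ)
    (hfeas : lpNorm p zbar ≤ (d : ℝ) ^ (1 / p.toReal))
    (hopt : ∀ z : (Σ j : Fin d, Fin (n j)) → ℝ,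
      lpNorm p z ≤ (d : ℝ) ^ (1 / p.toReal) →
      (∑ k : Fin d → (Σ j : Fin d, Fin (n j)), symTensor A k * ∏ s, z (k s)) ≤
        ∑ k : Fin d → (Σ j : Fin d, Fin (n j)), symTensor A k * ∏ s, zbar (k s)) :
    ∀ i : Fin d, lpNorm p (fun m : Fin (n i) => zbar ⟨i, m⟩) = 1 := by
  have hq : 0 < p.toReal := ENNReal.toReal_pos (by rintro rfl; simp at hp) hptop
  simp only [sum_symTensor_mul_prod, lpNorm_sigma_le_iff hq hptop] at hfeas hopt
  replace hopt (z : (Σ j : Fin d, Fin (n j)) → ℝ)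
      (hz : ∑ t, ∑ m, |z ⟨t, m⟩| ^ p.toReal ≤ d) : blockForm A z ≤ blockForm A zbar :=
    le_of_mul_le_mul_left (hopt z hz) (by positivity)
  have hpos : 0 < blockForm A zbar := by
    obtain ⟨z, hz, hz1⟩ := exists_blockForm_pos (by omega) hA hq
    exact hz.trans_le (hopt z (by simp [hz1]))
  set S : Fin d → ℝ := fun t => ∑ m, |zbar ⟨t, m⟩| ^ p.toReal with hS
  have hSpos (t : Fin d) : 0 < S t := by
    refine lt_of_le_of_ne (by positivity) fun h => hpos.ne' ?_
    refine blockForm_eq_zero_of_block A zbar t fun m => ?_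
    have := (Finset.sum_eq_zero_iff_of_nonneg (fun _ _ => by positivity)).mp h.symm m
      (Finset.mem_univ m)
    simpa using ((Real.rpow_eq_zero_iff_of_nonneg (abs_nonneg _)).mp this).1
  have hprod : 1 ≤ ∏ t, S t := by
    have hle := hopt (fun x => S x.1 ^ (-(1 / p.toReal)) * zbar x) <| by
      have hblock (t : Fin d) :
          ∑ m, |S t ^ (-(1 / p.toReal)) * zbar ⟨t, m⟩| ^ p.toReal = 1 := by
        have hc : (S t ^ (-(1 / p.toReal))) ^ p.toReal = (S t)⁻¹ := by
          rw [← Real.rpow_mul (hSpos t).le, ← Real.rpow_neg_one]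
          congr 1
          field_simp
        simp_rw [abs_mul, Real.mul_rpow (abs_nonneg _) (abs_nonneg _),
          abs_of_pos (Real.rpow_pos_of_pos (hSpos t) _), hc, ← Finset.mul_sum]
        exact inv_mul_cancel₀ (hSpos t).ne'
      simp only [hblock, Finset.sum_const, Finset.card_univ, Fintype.card_fin, nsmul_eq_mul,
        mul_one, le_refl]
    rw [blockForm_smul A zbar fun t => S t ^ (-(1 / p.toReal)),
      Real.finsetProd_rpow _ _ fun t _ => (hSpos t).le] at hle
    have hle1 := le_of_mul_le_mul_right (hle.trans_eq (one_mul _).symm) hpos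
    by_contra! hlt
    exact hle1.not_gt (Real.one_lt_rpow_of_pos_of_lt_one_of_neg
      (Finset.prod_pos fun t _ => hSpos t) hlt (by simpa using hq))
  intro i
  have hi : S i = 1 := eq_one_of_sum_le_card_of_one_le_prod hSpos (by simpa using hfeas) hprod i
  rw [lpNorm, if_neg hptop]
  simp only [hS] at hi
  rw [hi, Real.one_rpow]
end

section
/- Let p ∈ (2,∞] with conjugate q = p/(p−1), and let B be any real m×n matrix. Then vec_p(B) ≤ (π/(2·ln(1+√2))) · ‖B‖_{p→q}. -/
open scoped ENNReal
open Matrix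

/-- The convex relaxation value `vec_p(B)`: the supremum of `B̃ • X` over positive
semidefinite `X` with `∑_{i≤m} X_{ii}^{p/2} ≤ 1` and `∑_{j>m} X_{jj}^{p/2} ≤ 1`
(for `p = ∞`: all diagonal entries at most `1`), where
`B̃ = (1/2)·[[0,B],[Bᵀ,0]]` and `P • Q = tr(PᵀQ)`. -/
noncomputable def vecp {m n : ℕ} (p : ℝ≥0∞) (B : Matrix (Fin m) (Fin n) ℝ) : ℝ :=
  sSup {v : ℝ | ∃ X : Matrix (Fin m ⊕ Fin n) (Fin m ⊕ Fin n) ℝ,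
    X.PosSemidef ∧
    (if p = ∞ then ∀ i, X i i ≤ 1
     else
      (∑ i : Fin m, (X (Sum.inl i) (Sum.inl i)) ^ (p.toReal / 2)) ≤ 1 ∧
      (∑ j : Fin n, (X (Sum.inr j) (Sum.inr j)) ^ (p.toReal / 2)) ≤ 1) ∧
    Matrix.trace
      ((((1 : ℝ) / 2) • Matrix.fromBlocks (0 : Matrix (Fin m) (Fin m) ℝ) B
          Bᵀ (0 : Matrix (Fin n) (Fin n) ℝ))ᵀ * X) = v}

section

open MeasureTheory ProbabilityTheory

theorem Real.measurable_sign : Measurable Real.sign := by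
  unfold Real.sign
  refine Measurable.ite measurableSet_Iio measurable_const ?_
  exact Measurable.ite measurableSet_Ioi measurable_const measurable_const

theorem Real.abs_sign_le_one (x : ℝ) : |Real.sign x| ≤ 1 := by
  rcases Real.sign_apply_eq x with h | h | h <;> simp [h]

theorem Real.sign_mul_of_pos {r : ℝ} (hr : 0 < r) (x : ℝ) : Real.sign (r * x) = Real.sign x := by
  rcases lt_trichotomy x 0 with h | rfl | h
  · rw [Real.sign_of_neg h, Real.sign_of_neg (mul_neg_of_pos_of_neg hr h)]
  · simp
  · rw [Real.sign_of_pos h, Real.sign_of_pos (mul_pos hr h)]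

/-- The integral of a product of signs over a half circle. -/
theorem intervalIntegral_sign_cos_mul_sign_sin_half {ψ : ℝ}
    (hψ : ψ ∈ Set.Icc (-(Real.pi / 2)) (Real.pi / 2)) :
    ∫ θ in (-(Real.pi / 2))..(Real.pi / 2), Real.sign (Real.cos θ) * Real.sign (Real.sin (θ + ψ))
      = 2 * ψ := by
  obtain ⟨h1, h2⟩ := hψ
  have hm : Measurable fun θ : ℝ ↦ Real.sign (Real.cos θ) * Real.sign (Real.sin (θ + ψ)) :=
    (Real.measurable_sign.comp Real.measurable_cos).mul
      (Real.measurable_sign.comp (Real.measurable_sin.comp (measurable_id.add_const ψ)))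
  have hint (a b : ℝ) : IntervalIntegrable
      (fun θ : ℝ ↦ Real.sign (Real.cos θ) * Real.sign (Real.sin (θ + ψ))) volume a b := by
    refine (intervalIntegrable_const (c := (1 : ℝ))).mono_fun hm.aestronglyMeasurable ?_
    refine Filter.Eventually.of_forall fun θ ↦ ?_
    simp only [norm_mul, Real.norm_eq_abs, abs_one]
    exact mul_le_one₀ (Real.abs_sign_le_one _) (abs_nonneg _) (Real.abs_sign_le_one _)
  rw [← intervalIntegral.integral_add_adjacent_intervals (hint _ (-ψ)) (hint (-ψ) _)]
  have e1 : ∫ θ in (-(Real.pi / 2))..(-ψ),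
      Real.sign (Real.cos θ) * Real.sign (Real.sin (θ + ψ)) =
      ∫ θ in (-(Real.pi / 2))..(-ψ), (-1 : ℝ) := by
    rw [intervalIntegral.integral_of_le (by linarith), intervalIntegral.integral_of_le (by linarith),
      integral_Ioc_eq_integral_Ioo, integral_Ioc_eq_integral_Ioo]
    refine setIntegral_congr_fun measurableSet_Ioo fun θ hθ ↦ ?_
    obtain ⟨h3, h4⟩ := hθ
    have hc : 0 < Real.cos θ := Real.cos_pos_of_mem_Ioo ⟨by linarith, by linarith⟩
    have hs : Real.sin (θ + ψ) < 0 := Real.sin_neg_of_neg_of_neg_pi_lt (by linarith) (by linarith)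
    simp [Real.sign_of_pos hc, Real.sign_of_neg hs]
  have e2 : ∫ θ in (-ψ)..(Real.pi / 2),
      Real.sign (Real.cos θ) * Real.sign (Real.sin (θ + ψ)) =
      ∫ θ in (-ψ)..(Real.pi / 2), (1 : ℝ) := by
    rw [intervalIntegral.integral_of_le (by linarith), intervalIntegral.integral_of_le (by linarith),
      integral_Ioc_eq_integral_Ioo, integral_Ioc_eq_integral_Ioo]
    refine setIntegral_congr_fun measurableSet_Ioo fun θ hθ ↦ ?_
    obtain ⟨h3, h4⟩ := hθ
    have hc : 0 < Real.cos θ := Real.cos_pos_of_mem_Ioo ⟨by linarith, by linarith⟩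
    have hs : 0 < Real.sin (θ + ψ) := Real.sin_pos_of_pos_of_lt_pi (by linarith) (by linarith)
    simp [Real.sign_of_pos hc, Real.sign_of_pos hs]
  rw [e1, e2]
  simp
  ring

theorem setIntegral_sign_cos_mul_sign_sin {ψ : ℝ}
    (hψ : ψ ∈ Set.Icc (-(Real.pi / 2)) (Real.pi / 2)) :
    ∫ θ in Set.Ioo (-Real.pi) Real.pi, Real.sign (Real.cos θ) * Real.sign (Real.sin (θ + ψ))
      = 4 * ψ := by
  set f : ℝ → ℝ := fun θ ↦ Real.sign (Real.cos θ) * Real.sign (Real.sin (θ + ψ)) with hf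
  have hper : Function.Periodic f Real.pi := fun θ ↦ by
    have : θ + Real.pi + ψ = θ + ψ + Real.pi := by ring
    simp [hf, this, Real.cos_add_pi, Real.sin_add_pi, Real.sign_neg]
  have h := hper.intervalIntegral_add_zsmul_eq 2 (-Real.pi) fun a b ↦ ?_
  · rw [← integral_Ioc_eq_integral_Ioo, ← intervalIntegral.integral_of_le
      (by linarith [Real.pi_pos])]
    have e : -Real.pi + (2 : ℤ) • Real.pi = Real.pi := by simp; ring
    rw [e] at h
    rw [h, hper.intervalIntegral_add_eq (-Real.pi) (-(Real.pi / 2))]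
    have e' : -(Real.pi / 2) + Real.pi = Real.pi / 2 := by ring
    rw [e', hf, intervalIntegral_sign_cos_mul_sign_sin_half hψ]
    simp
    ring
  · have hm : Measurable f :=
      (Real.measurable_sign.comp Real.measurable_cos).mul
        (Real.measurable_sign.comp (Real.measurable_sin.comp (measurable_id.add_const ψ)))
    refine (intervalIntegrable_const (c := (1 : ℝ))).mono_fun hm.aestronglyMeasurable ?_
    refine Filter.Eventually.of_forall fun θ ↦ ?_
    simp only [hf, norm_mul, Real.norm_eq_abs, abs_one]
    exact mul_le_one₀ (Real.abs_sign_le_one _) (abs_nonneg _) (Real.abs_sign_le_one _)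

/-- Polar coordinates for the standard Gaussian measure on the plane. -/
theorem integral_gaussian_prod_eq_polar (f : ℝ × ℝ → ℝ)
    (hf : ∀ r > 0, ∀ x y, f (r * x, r * y) = f (x, y)) :
    ∫ z, f z ∂((gaussianReal 0 1).prod (gaussianReal 0 1)) =
      (∫ r in Set.Ioi (0 : ℝ), r * ((2 * Real.pi)⁻¹ * Real.exp (-r ^ 2 / 2))) *
        ∫ θ in Set.Ioo (-Real.pi) Real.pi, f (Real.cos θ, Real.sin θ) := by
  have h1 : ∫ z, f z ∂((gaussianReal 0 1).prod (gaussianReal 0 1)) =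
      ∫ z : ℝ × ℝ, ((2 * Real.pi)⁻¹ * Real.exp (-(z.1 ^ 2 + z.2 ^ 2) / 2)) * f z := by
    rw [gaussianReal_of_var_ne_zero _ one_ne_zero,
      prod_withDensity (measurable_gaussianPDF _ _) (measurable_gaussianPDF _ _),
      integral_withDensity_eq_integral_toReal_smul (by fun_prop)
        (Filter.Eventually.of_forall fun z ↦
          ENNReal.mul_lt_top gaussianPDF_lt_top gaussianPDF_lt_top)]
    refine integral_congr_ae (Filter.Eventually.of_forall fun z ↦ ?_)
    simp only [ENNReal.toReal_mul, toReal_gaussianPDF, gaussianPDFReal_def, smul_eq_mul,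
      NNReal.coe_one, mul_one, sub_zero]
    rw [mul_mul_mul_comm, ← Real.exp_add, ← mul_inv, Real.mul_self_sqrt (by positivity)]
    congr 3
    ring
  rw [h1, ← integral_comp_polarCoord_symm, polarCoord_target, ← setIntegral_prod_mul,
    Measure.volume_eq_prod]
  refine setIntegral_congr_fun (measurableSet_Ioi.prod measurableSet_Ioo) fun z hz ↦ ?_
  simp only [polarCoord_symm_apply, smul_eq_mul]
  rw [hf z.1 hz.1]
  have : (z.1 * Real.cos z.2) ^ 2 + (z.1 * Real.sin z.2) ^ 2 = z.1 ^ 2 := by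
    linear_combination z.1 ^ 2 * Real.sin_sq_add_cos_sq z.2
  rw [this]
  ring

/-- **Grothendieck's identity**, in the plane. -/
theorem integral_gaussian_prod_sign_mul_sign {ρ : ℝ} (hρ : ρ ∈ Set.Icc (-1) 1) :
    ∫ z : ℝ × ℝ, Real.sign z.1 * Real.sign (ρ * z.1 + √(1 - ρ ^ 2) * z.2)
      ∂((gaussianReal 0 1).prod (gaussianReal 0 1)) = 2 / Real.pi * Real.arcsin ρ := by
  have hC := integral_gaussian_prod_eq_polar (fun _ ↦ 1) (fun _ _ _ _ ↦ rfl)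
  rw [integral_gaussian_prod_eq_polar]
  · have e : ∀ θ, Real.sign (Real.cos θ) * Real.sign (ρ * Real.cos θ + √(1 - ρ ^ 2) * Real.sin θ) =
        Real.sign (Real.cos θ) * Real.sign (Real.sin (θ + Real.arcsin ρ)) := fun θ ↦ by
      rw [Real.sin_add, Real.cos_arcsin, Real.sin_arcsin hρ.1 hρ.2]
      ring_nf
    simp only [e]
    rw [setIntegral_sign_cos_mul_sign_sin (Real.arcsin_mem_Icc ρ)]
    have hpi := Real.pi_pos
    simp only [integral_const, probReal_univ, smul_eq_mul, mul_one, measureReal_restrict_apply,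
      MeasurableSet.univ, Set.univ_inter, Real.volume_real_Ioo_of_le (by linarith :
        -Real.pi ≤ Real.pi), sub_neg_eq_add] at hC
    generalize (∫ r in Set.Ioi (0 : ℝ), r * ((2 * Real.pi)⁻¹ * Real.exp (-r ^ 2 / 2))) = C at hC ⊢
    field_simp
    linear_combination (-2 * Real.arcsin ρ) * hC
  · intro r hr x y
    have : ρ * (r * x) + √(1 - ρ ^ 2) * (r * y) = r * (ρ * x + √(1 - ρ ^ 2) * y) := by ring
    simp only [this, Real.sign_mul_of_pos hr]

theorem charFunDual_gaussianReal_zero_one (L : StrongDual ℝ ℝ) :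
    charFunDual (gaussianReal 0 1) L = Complex.exp (-(L 1) ^ 2 / 2) := by
  have : L = InnerProductSpace.toDualMap ℝ ℝ (L 1) := by
    ext; simp
  conv_lhs => rw [this]
  rw [← charFun_eq_charFunDual_toDualMap, charFun_gaussianReal]
  simp [neg_div]

/-- The joint law of two coordinates of a normalized Gaussian vector. -/
theorem map_pair_multivariateGaussian {ι : Type*} [Fintype ι] [DecidableEq ι]
    {S : Matrix ι ι ℝ} (hS : S.PosSemidef) {i j : ι} (hi : S i i = 1) (hj : S j j = 1)
    (hij : S i j ∈ Set.Icc (-1) 1) :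
    (multivariateGaussian 0 S).map (fun x ↦ (x i, x j)) =
      ((gaussianReal 0 1).prod (gaussianReal 0 1)).map
        (fun z ↦ (z.1, S i j * z.1 + √(1 - S i j ^ 2) * z.2)) := by
  have hji : S j i = S i j := by simpa using hS.isHermitian.apply i j
  let T : EuclideanSpace ℝ ι →L[ℝ] ℝ × ℝ :=
    (EuclideanSpace.proj i).prod (EuclideanSpace.proj j)
  let T' : ℝ × ℝ →L[ℝ] ℝ × ℝ := (ContinuousLinearMap.fst ℝ ℝ ℝ).prod
    (S i j • ContinuousLinearMap.fst ℝ ℝ ℝ + √(1 - S i j ^ 2) • ContinuousLinearMap.snd ℝ ℝ ℝ)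
  change (multivariateGaussian 0 S).map T = ((gaussianReal 0 1).prod (gaussianReal 0 1)).map T'
  have := Measure.isProbabilityMeasure_map (μ := multivariateGaussian 0 S) (f := T) (by fun_prop)
  have := Measure.isProbabilityMeasure_map (μ := (gaussianReal 0 1).prod (gaussianReal 0 1))
    (f := T') (by fun_prop)
  apply Measure.ext_of_charFunDual
  ext L
  rw [charFunDual_map, charFunDual_map, charFunDual_prod, charFunDual_gaussianReal_zero_one,
    charFunDual_gaussianReal_zero_one]
  have hL (x y : ℝ) : L (x, y) = x * L (1, 0) + y * L (0, 1) := by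
    have : (x, y) = x • ((1 : ℝ), (0 : ℝ)) + y • ((0 : ℝ), (1 : ℝ)) := by simp
    rw [this, map_add, map_smul, map_smul, smul_eq_mul, smul_eq_mul]
  set a := L (1, 0)
  set b := L (0, 1)
  have hT : L.comp T = InnerProductSpace.toDualMap ℝ _
      (EuclideanSpace.single i a + EuclideanSpace.single j b) := by
    ext x
    simp [T, hL, EuclideanSpace.inner_single_left, mul_comm]
  rw [hT, ← charFun_eq_charFunDual_toDualMap, charFun_multivariateGaussian hS]
  have hq : (EuclideanSpace.single i a + EuclideanSpace.single j b : EuclideanSpace ℝ ι).ofLp ⬝ᵥ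
      S *ᵥ (EuclideanSpace.single i a + EuclideanSpace.single j b : EuclideanSpace ℝ ι).ofLp =
      a ^ 2 + b ^ 2 + 2 * a * b * S i j := by
    simp [Matrix.mulVec_add, hi, hj, hji]
    ring
  have hsq : √(1 - S i j ^ 2) ^ 2 = 1 - S i j ^ 2 := Real.sq_sqrt (by nlinarith [hij.1, hij.2])
  rw [hq, ← Complex.exp_add]
  have hsq' : (√(1 - S i j ^ 2) : ℂ) ^ 2 = 1 - (S i j : ℂ) ^ 2 := mod_cast hsq
  simp [T', hL]
  congr 1
  linear_combination (b ^ 2 / 2 : ℂ) * hsq'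

theorem integral_multivariateGaussian_sign_mul_sign {ι : Type*} [Fintype ι] [DecidableEq ι]
    {S : Matrix ι ι ℝ} (hS : S.PosSemidef) {i j : ι} (hi : S i i = 1) (hj : S j j = 1)
    (hij : S i j ∈ Set.Icc (-1) 1) :
    ∫ x, Real.sign (x i) * Real.sign (x j) ∂(multivariateGaussian 0 S) =
      2 / Real.pi * Real.arcsin (S i j) := by
  have hm : Measurable fun z : ℝ × ℝ ↦ Real.sign z.1 * Real.sign z.2 :=
    (Real.measurable_sign.comp measurable_fst).mul (Real.measurable_sign.comp measurable_snd)
  rw [← integral_gaussian_prod_sign_mul_sign hij]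
  calc
    _ = ∫ z, Real.sign z.1 * Real.sign z.2
          ∂((multivariateGaussian 0 S).map (fun x ↦ (x i, x j))) := by
      rw [integral_map (by fun_prop) hm.aestronglyMeasurable]
    _ = _ := by
      rw [map_pair_multivariateGaussian hS hi hj hij,
        integral_map (by fun_prop) hm.aestronglyMeasurable]

/-- The Cauchy-Schwarz inequality for the entries of a positive semidefinite matrix. -/
theorem Matrix.PosSemidef.apply_sq_le {ι : Type*} {X : Matrix ι ι ℝ} (hX : X.PosSemidef)
    (i j : ι) : X i j ^ 2 ≤ X i i * X j j := by
  have h := (hX.submatrix ![i, j]).det_nonneg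
  have hji : X j i = X i j := by simpa using hX.isHermitian.apply i j
  simp only [det_fin_two, submatrix_apply, cons_val_zero, cons_val_one, hji] at h
  nlinarith

/-- A positive semidefinite real matrix is a two-sided diagonal rescaling of a positive
semidefinite matrix with unit diagonal, away from the diagonal. -/
theorem Matrix.PosSemidef.exists_unit_diag {ι : Type*} [Fintype ι] [DecidableEq ι]
    {X : Matrix ι ι ℝ} (hX : X.PosSemidef) :
    ∃ G : Matrix ι ι ℝ, G.PosSemidef ∧ (∀ i, G i i = 1) ∧
      ∀ i j, i ≠ j → X i j = √(X i i) * √(X j j) * G i j := by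
  let d : ι → ℝ := fun i ↦ (√(X i i))⁻¹
  refine ⟨diagonal d * X * (diagonal d)ᴴ + diagonal fun i ↦ if X i i = 0 then 1 else 0,
    (hX.mul_mul_conjTranspose_same _).add ?_, fun i ↦ ?_, fun i j hij ↦ ?_⟩
  · refine PosSemidef.diagonal fun i ↦ ?_
    dsimp
    split_ifs <;> simp
  · by_cases h : X i i = 0
    · simp [d, h]
    · have h0 : 0 ≤ X i i := hX.diag_nonneg
      have : √(X i i) ≠ 0 := by rwa [Ne, Real.sqrt_eq_zero h0]
      simp [d, h]
      field_simp
      exact (Real.sq_sqrt h0).symm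
  · have hcs := hX.apply_sq_le i j
    have hi : 0 ≤ X i i := hX.diag_nonneg
    have hj : 0 ≤ X j j := hX.diag_nonneg
    by_cases h : X i i = 0 ∨ X j j = 0
    · have h0 : X i j = 0 := by
        have : X i i * X j j = 0 := mul_eq_zero.2 h
        nlinarith
      simp [d, h0, hij]
    · push Not at h
      have h1 : √(X i i) ≠ 0 := by rw [Ne, Real.sqrt_eq_zero hi]; exact h.1
      have h2 : √(X j j) ≠ 0 := by rw [Ne, Real.sqrt_eq_zero hj]; exact h.2
      simp [d, hij]
      field_simp

/-- Entrywise limits of sums of positive semidefinite real matrices are positive semidefinite. -/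
theorem Matrix.PosSemidef.of_hasSum_apply {ι : Type*} [Fintype ι] {T : ℕ → Matrix ι ι ℝ}
    {M : Matrix ι ι ℝ} (hT : ∀ k, (T k).PosSemidef)
    (hM : ∀ i j, HasSum (fun k ↦ T k i j) (M i j)) : M.PosSemidef := by
  refine PosSemidef.of_dotProduct_mulVec_nonneg ?_ fun x ↦ ?_
  · ext i j
    have h : (fun k ↦ T k j i) = fun k ↦ T k i j := by
      ext k
      simpa using (hT k).isHermitian.apply i j
    have hji := hM j i
    rw [h] at hji
    simpa using hji.unique (hM i j)
  · have hs : HasSum (fun k ↦ star x ⬝ᵥ (T k *ᵥ x)) (star x ⬝ᵥ (M *ᵥ x)) := by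
      simp only [dotProduct, mulVec]
      exact hasSum_sum fun i _ ↦ (hasSum_sum fun j _ ↦ (hM i j).mul_right _).mul_left _
    exact hs.nonneg fun k ↦ (hT k).dotProduct_mulVec_nonneg x

theorem Matrix.PosSemidef.map_pow_succ {ι : Type*} {G : Matrix ι ι ℝ} (hG : G.PosSemidef) (k : ℕ) :
    (G.map fun x ↦ x ^ (k + 1)).PosSemidef := by
  induction k with
  | zero => simpa using hG
  | succ k ih =>
    have h : (G.map fun x ↦ x ^ (k + 1 + 1)) = (G.map fun x ↦ x ^ (k + 1)) ⊙ G := by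
      ext i j
      simp [hadamard_apply, pow_succ]
    rw [h]
    exact ih.hadamard hG

/-- **Krivine's trick**: applying `sinh` to the diagonal blocks and `sin` to the off-diagonal
blocks preserves positive semidefiniteness. -/
theorem Matrix.PosSemidef.exists_sin_sinh {m n : Type*} [Fintype m] [Fintype n]
    {G : Matrix (m ⊕ n) (m ⊕ n) ℝ} (hG : G.PosSemidef) {c : ℝ} (hc : 0 ≤ c) :
    ∃ M : Matrix (m ⊕ n) (m ⊕ n) ℝ, M.PosSemidef ∧ (∀ i, M i i = Real.sinh (c * G i i)) ∧
      ∀ i j, M (.inl i) (.inr j) = Real.sin (c * G (.inl i) (.inr j)) := by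
  let v : ℕ → m ⊕ n → ℝ := fun k ↦ Sum.elim (fun _ ↦ 1) fun _ ↦ (-1) ^ k
  let T : ℕ → Matrix (m ⊕ n) (m ⊕ n) ℝ := fun k ↦
    (c ^ (2 * k + 1) / (2 * k + 1).factorial) •
      (vecMulVec (v k) (star (v k)) ⊙ G.map fun x ↦ x ^ (2 * k + 1))
  have hT (k) : (T k).PosSemidef :=
    ((posSemidef_vecMulVec_self_star (v k)).hadamard (hG.map_pow_succ (2 * k))).smul
      (by positivity)
  let M : Matrix (m ⊕ n) (m ⊕ n) ℝ := fun i j ↦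
    if i.isLeft = j.isLeft then Real.sinh (c * G i j) else Real.sin (c * G i j)
  refine ⟨M, .of_hasSum_apply hT ?_, fun i ↦ by simp [M], fun i j ↦ by simp [M]⟩
  rintro (i | i) (j | j)
  · convert! Real.hasSum_sinh (c * G (.inl i) (.inl j)) using 1
    ext k
    simp [T, v, hadamard_apply, vecMulVec_apply, mul_pow]
    ring
  · convert! Real.hasSum_sin (c * G (.inl i) (.inr j)) using 1
    ext k
    simp [T, v, hadamard_apply, vecMulVec_apply, mul_pow]
    ring
  · convert! Real.hasSum_sin (c * G (.inr i) (.inl j)) using 1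
    ext k
    simp [T, v, hadamard_apply, vecMulVec_apply, mul_pow]
    ring
  · convert! Real.hasSum_sinh (c * G (.inr i) (.inr j)) using 1
    ext k
    have hk : (-1 : ℝ) ^ k * (-1) ^ k = 1 := by rw [← mul_pow]; simp
    simp [T, v, hadamard_apply, vecMulVec_apply, mul_pow, hk]
    ring

/-- **Grothendieck's inequality** with Krivine's constant, for a Gram matrix of unit vectors. -/
theorem grothendieck_inequality_krivine {m n : Type*} [Fintype m] [Fintype n]
    (A : Matrix m n ℝ) {G : Matrix (m ⊕ n) (m ⊕ n) ℝ} (hG : G.PosSemidef) (hd : ∀ i, G i i = 1)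
    {N : ℝ} (hN : ∀ (s : m → ℝ) (t : n → ℝ), (∀ i, |s i| ≤ 1) → (∀ j, |t j| ≤ 1) →
      ∑ i, ∑ j, A i j * (s i * t j) ≤ N) :
    ∑ i, ∑ j, A i j * G (.inl i) (.inr j) ≤
      Real.pi / (2 * Real.log (1 + √2)) * N := by
  classical
  set c := Real.log (1 + √2) with hc_def
  have hc : c = Real.arsinh 1 := by rw [hc_def, Real.arsinh]; norm_num
  have hc0 : 0 < c := hc ▸ Real.arsinh_pos_iff.2 one_pos
  have hsc : Real.sinh c = 1 := by rw [hc, Real.sinh_arsinh]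
  have hc1 : c ≤ 1 := hsc ▸ Real.self_le_sinh_iff.2 hc0.le
  obtain ⟨M, hM, hMd, hMo⟩ := hG.exists_sin_sinh hc0.le
  have hM1 (i) : M i i = 1 := by rw [hMd, hd, mul_one, hsc]
  have hG1 (i j) : |G i j| ≤ 1 := by
    have := hG.apply_sq_le i j
    rw [hd, hd, mul_one] at this
    exact abs_le_one_iff_mul_self_le_one.2 (by nlinarith)
  have hMI (i j) : M i j ∈ Set.Icc (-1) 1 := by
    have := hM.apply_sq_le i j
    rw [hM1, hM1, mul_one] at this
    exact abs_le.1 (abs_le_one_iff_mul_self_le_one.2 (by nlinarith))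
  let μ := multivariateGaussian 0 M
  have hint (i j) : Integrable (fun x : EuclideanSpace ℝ (m ⊕ n) ↦
      Real.sign (x i) * Real.sign (x j)) μ := by
    refine Integrable.of_bound (C := 1) ?_ (Filter.Eventually.of_forall fun x ↦ ?_)
    · have h (k : m ⊕ n) : Measurable fun x : EuclideanSpace ℝ (m ⊕ n) ↦ Real.sign (x k) :=
        Real.measurable_sign.comp (by fun_prop)
      exact ((h i).mul (h j)).aestronglyMeasurable
    · rw [norm_mul]
      exact mul_le_one₀ (Real.abs_sign_le_one _) (norm_nonneg _) (Real.abs_sign_le_one _)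
  have key (i j) : c * G (.inl i) (.inr j) = Real.pi / 2 *
      ∫ x, Real.sign (x (.inl i)) * Real.sign (x (.inr j)) ∂μ := by
    rw [integral_multivariateGaussian_sign_mul_sign hM (hM1 _) (hM1 _) (hMI _ _), hMo,
      Real.arcsin_sin]
    · field_simp
    · nlinarith [Real.pi_gt_three, (abs_le.1 (hG1 (.inl i) (.inr j))).1]
    · nlinarith [Real.pi_gt_three, (abs_le.1 (hG1 (.inl i) (.inr j))).2]
  have hE : ∑ i, ∑ j, A i j * ∫ x, Real.sign (x (.inl i)) * Real.sign (x (.inr j)) ∂μ ≤ N := by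
    calc
      _ = ∫ x, ∑ i, ∑ j, A i j * (Real.sign (x (.inl i)) * Real.sign (x (.inr j))) ∂μ := by
        have hA (i j) := (hint (.inl i) (.inr j)).const_mul (A i j)
        simp only [← integral_const_mul]
        rw [integral_finsetSum]
        · refine Finset.sum_congr rfl fun i _ ↦ ?_
          rw [integral_finsetSum]
          exact fun j _ ↦ hA i j
        · exact fun i _ ↦ integrable_finsetSum _ fun j _ ↦ hA i j
      _ ≤ ∫ _, N ∂μ := by
        refine integral_mono (integrable_finsetSum _ fun i _ ↦ integrable_finsetSum _ fun j _ ↦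
          (hint (.inl i) (.inr j)).const_mul _) (integrable_const _) fun x ↦ ?_
        exact hN _ _ (fun _ ↦ Real.abs_sign_le_one _) fun _ ↦ Real.abs_sign_le_one _
      _ = N := by simp [μ]
  have hpi := Real.pi_pos
  calc
    _ = Real.pi / (2 * c) *
        ∑ i, ∑ j, A i j * ∫ x, Real.sign (x (.inl i)) * Real.sign (x (.inr j)) ∂μ := by
      simp only [Finset.mul_sum]
      refine Finset.sum_congr rfl fun i _ ↦ Finset.sum_congr rfl fun j _ ↦ ?_
      have h := key i j
      generalize (∫ x, Real.sign (x (.inl i)) * Real.sign (x (.inr j)) ∂μ) = I at h ⊢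
      field_simp
      linear_combination (2 * A i j) * h
    _ ≤ _ := by gcongr

theorem trace_half_fromBlocks_transpose_mul {m n : Type*} [Fintype m] [Fintype n]
    (B : Matrix m n ℝ) {X : Matrix (m ⊕ n) (m ⊕ n) ℝ} (hX : X.IsSymm) :
    Matrix.trace ((((1 : ℝ) / 2) • Matrix.fromBlocks (0 : Matrix m m ℝ) B
      Bᵀ (0 : Matrix n n ℝ))ᵀ * X) = ∑ i, ∑ j, B i j * X (.inl i) (.inr j) := by
  have h : ∀ i j, X (.inr j) (.inl i) = X (.inl i) (.inr j) := fun i j ↦ hX.apply _ _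
  simp only [trace, diag_apply, mul_apply, transpose_apply, Matrix.smul_apply, smul_eq_mul,
    Fintype.sum_sum_type, fromBlocks_apply₁₁, fromBlocks_apply₁₂, fromBlocks_apply₂₁,
    fromBlocks_apply₂₂, Matrix.zero_apply, mul_zero, zero_mul, Finset.sum_const_zero, zero_add, add_zero, h]
  rw [Finset.sum_comm (s := (Finset.univ : Finset n)), ← Finset.sum_add_distrib]
  refine Finset.sum_congr rfl fun i _ ↦ ?_
  rw [← Finset.sum_add_distrib]
  refine Finset.sum_congr rfl fun j _ ↦ ?_
  ring

end

theorem lpNorm_nonneg {ι : Type*} [Fintype ι] (p : ℝ≥0∞) (x : ι → ℝ) : 0 ≤ lpNorm p x := by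
  unfold lpNorm
  split_ifs
  · exact Real.iSup_nonneg fun i ↦ abs_nonneg _
  · positivity

theorem abs_apply_le_lpNorm {ι : Type*} [Fintype ι] {p : ℝ≥0∞} (hp : p ≠ 0) (x : ι → ℝ) (i : ι) :
    |x i| ≤ lpNorm p x := by
  unfold lpNorm
  split_ifs with h
  · exact le_ciSup (f := fun i ↦ |x i|) (Set.finite_range _).bddAbove i
  · have hp' : 0 < p.toReal := ENNReal.toReal_pos hp h
    calc
      |x i| = (|x i| ^ p.toReal) ^ (1 / p.toReal) := by
        rw [← Real.rpow_mul (abs_nonneg _), mul_one_div_cancel hp'.ne', Real.rpow_one]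
      _ ≤ _ := by
        gcongr
        exact Finset.single_le_sum (f := fun i ↦ |x i| ^ p.toReal)
          (fun j _ ↦ by positivity) (Finset.mem_univ i)

theorem lpNorm_mono {ι : Type*} [Fintype ι] (p : ℝ≥0∞) {x y : ι → ℝ}
    (h : ∀ i, |x i| ≤ |y i|) : lpNorm p x ≤ lpNorm p y := by
  unfold lpNorm
  split_ifs
  · exact ciSup_mono (Set.finite_range _).bddAbove h
  · refine Real.rpow_le_rpow (by positivity) (Finset.sum_le_sum fun i _ ↦ ?_) (by positivity)
    exact Real.rpow_le_rpow (abs_nonneg _) (h i) ENNReal.toReal_nonneg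

/-- Hölder's inequality for `lpNorm`. -/
theorem sum_mul_le_lpNorm_mul_lpNorm {ι : Type*} [Fintype ι] {p : ℝ≥0∞} (hp : 1 < p)
    (x y : ι → ℝ) : ∑ i, x i * y i ≤ lpNorm p x *
      lpNorm (if p = ∞ then 1 else ENNReal.ofReal (p.toReal / (p.toReal - 1))) y := by
  by_cases h : p = ∞
  · subst h
    have hx := abs_apply_le_lpNorm ENNReal.top_ne_zero x
    rw [if_pos rfl, lpNorm.eq_def 1, if_neg ENNReal.one_ne_top]
    simp only [ENNReal.toReal_one, Real.rpow_one, div_one, Finset.mul_sum]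
    refine Finset.sum_le_sum fun i _ ↦ (le_abs_self _).trans ?_
    rw [abs_mul]
    gcongr
    exact hx i
  · have hp1 : 1 < p.toReal := by
      rw [← ENNReal.toReal_one]
      exact (ENNReal.toReal_lt_toReal ENNReal.one_ne_top h).2 hp
    have hq : 0 < p.toReal / (p.toReal - 1) := div_pos (by linarith) (by linarith)
    rw [if_neg h, lpNorm, lpNorm, if_neg h, if_neg ENNReal.ofReal_ne_top,
      ENNReal.toReal_ofReal hq.le]
    exact Real.inner_le_Lp_mul_Lq _ x y (Real.HolderConjugate.conjExponent hp1)

/-- Bounds on the diagonal of `X` in the relaxation are norm bounds on its square roots. -/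
theorem lpNorm_sqrt_le_one {ι : Type*} [Fintype ι] {p : ℝ≥0∞} {x : ι → ℝ} (hx : ∀ i, 0 ≤ x i)
    (h : if p = ∞ then ∀ i, x i ≤ 1 else ∑ i, x i ^ (p.toReal / 2) ≤ 1) :
    lpNorm p (fun i ↦ √(x i)) ≤ 1 := by
  unfold lpNorm
  split_ifs at h ⊢ with hp
  · refine Real.iSup_le (fun i ↦ ?_) zero_le_one
    rw [abs_of_nonneg (Real.sqrt_nonneg _)]
    exact Real.sqrt_le_one.2 (h i)
  · refine Real.rpow_le_one (by positivity) ?_ (by positivity)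
    convert h using 2 with i
    rw [abs_of_nonneg (Real.sqrt_nonneg _), Real.sqrt_eq_rpow, ← Real.rpow_mul (hx i)]
    congr 1
    ring

theorem bddAbove_lpNorm_mulVec {m n : Type*} [Fintype m] [Fintype n] {p : ℝ≥0∞} (hp : p ≠ 0)
    (q : ℝ≥0∞) (B : Matrix m n ℝ) :
    BddAbove {v : ℝ | ∃ y : n → ℝ, lpNorm p y ≤ 1 ∧ lpNorm q (B.mulVec y) = v} := by
  refine ⟨lpNorm q fun i ↦ ∑ j, |B i j|, ?_⟩
  rintro v ⟨y, hy, rfl⟩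
  refine lpNorm_mono q fun i ↦ ?_
  rw [abs_of_nonneg (a := ∑ j, |B i j|) (by positivity)]
  refine (Finset.abs_sum_le_sum_abs _ _).trans (Finset.sum_le_sum fun j _ ↦ ?_)
  rw [abs_mul]
  exact mul_le_of_le_one_right (abs_nonneg _) ((abs_apply_le_lpNorm hp y j).trans hy)

/-- For `p ∈ (2,∞]` with conjugate `q = p/(p−1)`, and any real `m×n` matrix `B`,
`vec_p(B) ≤ (π/(2·ln(1+√2))) · ‖B‖_{p→q}` (Grothendieck-type bound). -/
theorem vecp_le_grothendieck_mul_pq_norm (m n : ℕ) (p : ℝ≥0∞) (hp : 2 < p)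
    (B : Matrix (Fin m) (Fin n) ℝ) :
    vecp p B ≤ (Real.pi / (2 * Real.log (1 + Real.sqrt 2))) *
      sSup {v : ℝ | ∃ y : Fin n → ℝ, lpNorm p y ≤ 1 ∧
        lpNorm (if p = ∞ then 1 else ENNReal.ofReal (p.toReal / (p.toReal - 1)))
          (B.mulVec y) = v} := by
  set q := if p = ∞ then 1 else ENNReal.ofReal (p.toReal / (p.toReal - 1))
  set N := sSup {v : ℝ | ∃ y : Fin n → ℝ, lpNorm p y ≤ 1 ∧ lpNorm q (B.mulVec y) = v}
  have hp1 : 1 < p := lt_trans (by norm_num) hp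
  have hp0 : p ≠ 0 := (zero_lt_one.trans hp1).ne'
  have hbdd := bddAbove_lpNorm_mulVec hp0 q B
  have hN0 : 0 ≤ N := by
    refine Real.sSup_nonneg ?_
    rintro v ⟨y, -, rfl⟩
    exact lpNorm_nonneg _ _
  have hlog : 0 ≤ Real.log (1 + √2) := Real.log_nonneg (by linarith [Real.sqrt_nonneg 2])
  have hpi := Real.pi_pos
  refine Real.sSup_le ?_ (by positivity)
  rintro v ⟨X, hX, hXd, rfl⟩
  rw [trace_half_fromBlocks_transpose_mul B (by simpa [IsHermitian, IsSymm] using hX.isHermitian)]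
  obtain ⟨G, hG, hG1, hXG⟩ := hX.exists_unit_diag
  let a : Fin m → ℝ := fun i ↦ √(X (.inl i) (.inl i))
  let b : Fin n → ℝ := fun j ↦ √(X (.inr j) (.inr j))
  have ha : lpNorm p a ≤ 1 := by
    refine lpNorm_sqrt_le_one (x := fun i ↦ X (.inl i) (.inl i)) (fun _ ↦ hX.diag_nonneg) ?_
    split_ifs at hXd ⊢
    · exact fun i ↦ hXd _
    · exact hXd.1
  have hb : lpNorm p b ≤ 1 := by
    refine lpNorm_sqrt_le_one (x := fun j ↦ X (.inr j) (.inr j)) (fun _ ↦ hX.diag_nonneg) ?_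
    split_ifs at hXd ⊢
    · exact fun i ↦ hXd _
    · exact hXd.2
  have hscale {k : ℕ} (x s : Fin k → ℝ) (hs : ∀ i, |s i| ≤ 1) :
      lpNorm p (fun i ↦ x i * s i) ≤ lpNorm p x := lpNorm_mono p fun i ↦ by
    rw [abs_mul]
    exact mul_le_of_le_one_right (abs_nonneg _) (hs i)
  calc
    _ = ∑ i, ∑ j, (Matrix.of fun i j ↦ B i j * (a i * b j)) i j * G (.inl i) (.inr j) := by
      refine Finset.sum_congr rfl fun i _ ↦ Finset.sum_congr rfl fun j _ ↦ ?_
      rw [hXG _ _ Sum.inl_ne_inr, of_apply, mul_assoc (B i j)]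
    _ ≤ _ := by
      refine grothendieck_inequality_krivine _ hG hG1 fun s t hs ht ↦ ?_
      calc
        _ = ∑ i, (a i * s i) * (B.mulVec fun j ↦ b j * t j) i := by
          simp only [mulVec, dotProduct, Finset.mul_sum, of_apply]
          refine Finset.sum_congr rfl fun i _ ↦ Finset.sum_congr rfl fun j _ ↦ ?_
          ring
        _ ≤ lpNorm p (fun i ↦ a i * s i) * lpNorm q (B.mulVec fun j ↦ b j * t j) :=
          sum_mul_le_lpNorm_mul_lpNorm hp1 _ _
        _ ≤ lpNorm q (B.mulVec fun j ↦ b j * t j) :=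
          mul_le_of_le_one_left (lpNorm_nonneg _ _) ((hscale a s hs).trans ha)
        _ ≤ N := le_csSup hbdd ⟨_, (hscale b t ht).trans hb, rfl⟩
end

section
/- Let n ≥ 1 be an integer and let ζ = (ζ_1,…,ζ_n) be uniformly distributed on {−1,1}^n (i.e., ζ_1,…,ζ_n are i.i.d. Bernoulli random variables taking values ±1 with probability 1/2 each). Then for every w ∈ ℝ^n, Pr( ⟨w,ζ⟩ ≥ √((log n)/(48·n)) · ‖w‖_1 ) ≥ (1/72) · n^{−1/48}. -/
/-- The `±1` sign encoded by a Boolean. -/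
noncomputable def boolSign (a : Bool) : ℝ := if a then 1 else -1

/-- The weight of a sign pattern when the signs are independent with means `b i`. -/
noncomputable def biasedWeight {n : ℕ} (b : Fin n → ℝ) (ξ : Fin n → Bool) : ℝ :=
  ∏ i, (1 + b i * boolSign (ξ i)) / 2

/-- The linear form with coefficients `w` in the centred signs. -/
noncomputable def centredSum {n : ℕ} (b w : Fin n → ℝ) (ξ : Fin n → Bool) : ℝ :=
  ∑ i, w i * (boolSign (ξ i) - b i)

theorem sum_fin_succ_bool {n : ℕ} (F : (Fin (n + 1) → Bool) → ℝ) :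
    ∑ ξ, F ξ = ∑ ξ : Fin n → Bool, (F (Fin.cons true ξ) + F (Fin.cons false ξ)) := by
  rw [← (Fin.consEquiv fun _ : Fin (n + 1) => Bool).sum_comp, Fintype.sum_prod_type,
    Fintype.sum_bool, ← Finset.sum_add_distrib]
  rfl

theorem biasedWeight_cons {n : ℕ} (b : Fin (n + 1) → ℝ) (a : Bool) (ξ : Fin n → Bool) :
    biasedWeight b (Fin.cons a ξ) =
      (1 + b 0 * boolSign a) / 2 * biasedWeight (fun i => b i.succ) ξ := by
  simp only [biasedWeight, Fin.prod_univ_succ, Fin.cons_zero, Fin.cons_succ]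

theorem centredSum_cons {n : ℕ} (b w : Fin (n + 1) → ℝ) (a : Bool) (ξ : Fin n → Bool) :
    centredSum b w (Fin.cons a ξ) =
      w 0 * (boolSign a - b 0) + centredSum (fun i => b i.succ) (fun i => w i.succ) ξ := by
  simp [centredSum, Fin.sum_univ_succ]

theorem biasedWeight_nonneg {n : ℕ} {b : Fin n → ℝ} (hb : ∀ i, b i ^ 2 ≤ 1)
    (ξ : Fin n → Bool) : 0 ≤ biasedWeight b ξ := by
  refine Finset.prod_nonneg fun i _ => ?_
  have h := abs_le.1 ((sq_le_one_iff_abs_le_one _).1 (hb i))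
  unfold boolSign
  split_ifs <;> linarith

theorem sum_biasedWeight {n : ℕ} (b : Fin n → ℝ) : ∑ ξ, biasedWeight b ξ = 1 := by
  induction n with
  | zero => simp [biasedWeight]
  | succ n ih =>
    rw [sum_fin_succ_bool, ← ih fun i => b i.succ]
    refine Finset.sum_congr rfl fun ξ _ => ?_
    simp only [biasedWeight_cons, boolSign]
    norm_num
    ring

theorem sum_biasedWeight_sq {n : ℕ} (b : Fin n → ℝ) :
    ∑ ξ, biasedWeight b ξ ^ 2 = ∏ i, (1 + b i ^ 2) / 2 := by
  induction n with
  | zero => simp [biasedWeight]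
  | succ n ih =>
    rw [sum_fin_succ_bool, Fin.prod_univ_succ, ← ih fun i => b i.succ, Finset.mul_sum]
    refine Finset.sum_congr rfl fun ξ _ => ?_
    simp only [biasedWeight_cons, boolSign]
    norm_num
    ring

theorem sum_biasedWeight_mul_centredSum {n : ℕ} (b w : Fin n → ℝ) :
    ∑ ξ, biasedWeight b ξ * centredSum b w ξ = 0 := by
  induction n with
  | zero => simp [centredSum]
  | succ n ih =>
    rw [sum_fin_succ_bool, ← ih (fun i => b i.succ) fun i => w i.succ]
    refine Finset.sum_congr rfl fun ξ _ => ?_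
    simp only [biasedWeight_cons, centredSum_cons, boolSign]
    norm_num
    ring

theorem sum_biasedWeight_mul_centredSum_sq {n : ℕ} (b w : Fin n → ℝ) :
    ∑ ξ, biasedWeight b ξ * centredSum b w ξ ^ 2 = ∑ i, w i ^ 2 * (1 - b i ^ 2) := by
  induction n with
  | zero => simp [centredSum]
  | succ n ih =>
    rw [sum_fin_succ_bool, Fin.sum_univ_succ, ← ih (fun i => b i.succ) fun i => w i.succ,
      ← mul_one (w 0 ^ 2 * (1 - b 0 ^ 2))]
    nth_rw 2 [← sum_biasedWeight fun i => b i.succ]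
    rw [Finset.mul_sum, ← Finset.sum_add_distrib]
    refine Finset.sum_congr rfl fun ξ _ => ?_
    simp only [biasedWeight_cons, centredSum_cons, boolSign]
    norm_num
    ring

theorem sum_biasedWeight_mul_centredSum_pow_four_le {n : ℕ} (b w : Fin n → ℝ)
    (hb : ∀ i, b i ^ 2 ≤ 1 / 3) :
    ∑ ξ, biasedWeight b ξ * centredSum b w ξ ^ 4 ≤
      3 * (∑ i, w i ^ 2 * (1 - b i ^ 2)) ^ 2 := by
  induction n with
  | zero => simp [centredSum]
  | succ n ih =>
    have h4 := ih (fun i => b i.succ) (fun i => w i.succ) fun i => hb i.succ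
    have h2 := sum_biasedWeight_mul_centredSum_sq (fun i => b i.succ) fun i => w i.succ
    have h1 := sum_biasedWeight_mul_centredSum (fun i => b i.succ) fun i => w i.succ
    have h0 := sum_biasedWeight fun i => b i.succ
    have key : ∑ ξ, biasedWeight b ξ * centredSum b w ξ ^ 4 =
        w 0 ^ 4 * ((1 - b 0 ^ 2) * (1 + 3 * b 0 ^ 2)) *
            (∑ ξ, biasedWeight (fun i => b i.succ) ξ) +
          w 0 ^ 3 * (-8 * b 0 * (1 - b 0 ^ 2)) *
            (∑ ξ, biasedWeight (fun i => b i.succ) ξ *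
              centredSum (fun i => b i.succ) (fun i => w i.succ) ξ) +
          6 * (w 0 ^ 2 * (1 - b 0 ^ 2)) *
            (∑ ξ, biasedWeight (fun i => b i.succ) ξ *
              centredSum (fun i => b i.succ) (fun i => w i.succ) ξ ^ 2) +
          ∑ ξ, biasedWeight (fun i => b i.succ) ξ *
            centredSum (fun i => b i.succ) (fun i => w i.succ) ξ ^ 4 := by
      rw [sum_fin_succ_bool]
      simp only [Finset.mul_sum, ← Finset.sum_add_distrib]
      refine Finset.sum_congr rfl fun ξ _ => ?_
      simp only [biasedWeight_cons, centredSum_cons, boolSign]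
      norm_num
      ring
    rw [key, h0, h1, h2, Fin.sum_univ_succ]
    have hs : 0 ≤ w 0 ^ 4 * ((1 - b 0 ^ 2) * (2 - 6 * b 0 ^ 2)) := by
      have := hb 0
      exact mul_nonneg (by positivity) (mul_nonneg (by linarith) (by linarith))
    linarith

/-- A centred variable whose fourth moment is at most three times its squared variance is
nonnegative with probability at least `3 / 20`. -/
theorem sum_filter_nonneg_ge_of_fourth_moment {α : Type*} [Fintype α] (p Y : α → ℝ) {V : ℝ}
    (hp : ∀ a, 0 ≤ p a) (hV : 0 < V) (h1 : ∑ a, p a * Y a = 0)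
    (h2 : ∑ a, p a * Y a ^ 2 = V) (h4 : ∑ a, p a * Y a ^ 4 ≤ 3 * V ^ 2) :
    3 / 20 ≤ ∑ a with 0 ≤ Y a, p a := by
  set r := √(2 * V)
  have hr : 0 < r := by positivity
  have hr2 : r ^ 2 = 2 * V := Real.sq_sqrt (by positivity)
  have pointwise : ∀ a, p a * (2 * (Y a / r) + 3 * (Y a / r) ^ 2 - (Y a / r) ^ 4) / 5 ≤
      if 0 ≤ Y a then p a else 0 := by
    intro a
    set u := Y a / r with hu
    split_ifs with h
    · have : 2 * u + 3 * u ^ 2 - u ^ 4 ≤ 5 := by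
        nlinarith [sq_nonneg (u ^ 2 - 2), sq_nonneg (u - 1)]
      nlinarith [hp a]
    · have hneg : u ≤ 0 := div_nonpos_of_nonpos_of_nonneg (not_le.1 h).le hr.le
      have : 2 * u + 3 * u ^ 2 - u ^ 4 ≤ 0 := by
        have h3 : 0 ≤ (-u) * ((u + 1) ^ 2 * (2 - u)) :=
          mul_nonneg (by linarith) (mul_nonneg (sq_nonneg _) (by linarith))
        linarith
      nlinarith [hp a]
  rw [Finset.sum_filter]
  refine le_trans ?_ (Finset.sum_le_sum fun a _ => pointwise a)
  have expand : ∑ a, p a * (2 * (Y a / r) + 3 * (Y a / r) ^ 2 - (Y a / r) ^ 4) / 5 =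
      2 / (5 * r) * (∑ a, p a * Y a) + 3 / (5 * r ^ 2) * (∑ a, p a * Y a ^ 2) -
        1 / (5 * (r ^ 2) ^ 2) * ∑ a, p a * Y a ^ 4 := by
    simp only [Finset.mul_sum, ← Finset.sum_add_distrib, ← Finset.sum_sub_distrib]
    refine Finset.sum_congr rfl fun a _ => ?_
    field_simp
  rw [expand, h1, h2, hr2]
  have hle := mul_le_mul_of_nonneg_left h4 (show 0 ≤ 1 / (5 * (2 * V) ^ 2) by positivity)
  have e1 : 1 / (5 * (2 * V) ^ 2) * (3 * V ^ 2) = 3 / 20 := by field_simp; norm_num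
  have e2 : 3 / (5 * (2 * V)) * V = 3 / 10 := by field_simp; norm_num
  linarith

theorem biasedWeight_centredSum_nonneg_ge {n : ℕ} (b w : Fin n → ℝ)
    (hb : ∀ i, b i ^ 2 ≤ 1 / 3) :
    3 / 20 ≤ ∑ ξ with 0 ≤ centredSum b w ξ, biasedWeight b ξ := by
  by_cases hw : w = 0
  · simp [hw, centredSum, sum_biasedWeight]
    norm_num
  · refine sum_filter_nonneg_ge_of_fourth_moment _ _
      (biasedWeight_nonneg fun i => (hb i).trans (by norm_num)) ?_
      (sum_biasedWeight_mul_centredSum b w) (sum_biasedWeight_mul_centredSum_sq b w)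
      (sum_biasedWeight_mul_centredSum_pow_four_le b w hb)
    obtain ⟨i, hi⟩ := Function.ne_iff.1 hw
    refine Finset.sum_pos' (fun j _ => mul_nonneg (sq_nonneg _) (by linarith [hb j]))
      ⟨i, Finset.mem_univ i, mul_pos (even_two.pow_pos hi) (by linarith [hb i])⟩

/-- Khot–Naor probabilistic lemma (`L_∞` case): if `ζ` is uniform on `{−1,1}^n`, then
for every `w ∈ ℝ^n`, `Pr(⟨w,ζ⟩ ≥ √(log n/(48 n)) · ‖w‖₁) ≥ (1/72)·n^{−1/48}`.
The uniform probability is expressed by counting sign patterns. -/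
theorem bernoulli_inner_large_prob (n : ℕ) (hn : 1 ≤ n) (w : Fin n → ℝ) :
    (1 / 72 : ℝ) * (n : ℝ) ^ (-(1 : ℝ) / 48) ≤
      ((Finset.univ.filter fun ξ : Fin n → Bool =>
          Real.sqrt (Real.log n / (48 * n)) * (∑ i, |w i|) ≤
            ∑ i, w i * (if ξ i then 1 else -1)).card : ℝ) / 2 ^ n := by
  have hn0 : (0 : ℝ) < n := by exact_mod_cast hn
  have hlog : 0 ≤ Real.log n := Real.log_nonneg (by exact_mod_cast hn)
  set s := √(Real.log n / (48 * n)) with hs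
  have hs2 : s ^ 2 = Real.log n / (48 * n) := Real.sq_sqrt (by positivity)
  set b : Fin n → ℝ := fun i => if 0 ≤ w i then s else -s with hb
  have hbsq : ∀ i, b i ^ 2 = s ^ 2 := fun i => by
    simp only [hb]; split_ifs <;> ring
  have hwb : ∀ i, w i * b i = s * |w i| := fun i => by
    simp only [hb]
    split_ifs with h
    · rw [abs_of_nonneg h, mul_comm]
    · rw [abs_of_neg (not_le.1 h)]; ring
  have hsmall : s ^ 2 ≤ 1 / 3 := by
    rw [hs2, div_le_iff₀ (by positivity)]
    linarith [Real.log_le_self hn0.le]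
  have hset : (Finset.univ.filter fun ξ : Fin n → Bool =>
      s * (∑ i, |w i|) ≤ ∑ i, w i * (if ξ i then 1 else -1)) =
      Finset.univ.filter fun ξ => 0 ≤ centredSum b w ξ := by
    refine Finset.filter_congr fun ξ _ => ?_
    simp only [centredSum, boolSign, mul_sub, Finset.sum_sub_distrib, hwb, ← Finset.mul_sum,
      sub_nonneg]
  rw [hset]
  set A := Finset.univ.filter fun ξ => 0 ≤ centredSum b w ξ
  have hA : 3 / 20 ≤ ∑ ξ ∈ A, biasedWeight b ξ :=
    biasedWeight_centredSum_nonneg_ge b w fun i => (hbsq i).trans_le hsmall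
  have hsecond : ∑ ξ ∈ A, biasedWeight b ξ ^ 2 ≤ (n : ℝ) ^ ((1 : ℝ) / 48) / 2 ^ n := by
    calc ∑ ξ ∈ A, biasedWeight b ξ ^ 2 ≤ ∑ ξ, biasedWeight b ξ ^ 2 :=
          Finset.sum_le_univ_sum_of_nonneg fun _ => sq_nonneg _
      _ = (1 + s ^ 2) ^ n / 2 ^ n := by
          simp [sum_biasedWeight_sq, hbsq]
      _ ≤ (n : ℝ) ^ ((1 : ℝ) / 48) / 2 ^ n := by
          gcongr
          calc (1 + s ^ 2) ^ n ≤ Real.exp (s ^ 2) ^ n := by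
                gcongr
                linarith [Real.add_one_le_exp (s ^ 2)]
            _ = (n : ℝ) ^ ((1 : ℝ) / 48) := by
                rw [← Real.exp_nat_mul, Real.rpow_def_of_pos hn0, hs2]
                congr 1
                field_simp
  have hcs : (3 / 20 : ℝ) ^ 2 ≤ A.card * ((n : ℝ) ^ ((1 : ℝ) / 48) / 2 ^ n) :=
    calc (3 / 20 : ℝ) ^ 2 ≤ (∑ ξ ∈ A, biasedWeight b ξ) ^ 2 := by gcongr
      _ ≤ A.card * ∑ ξ ∈ A, biasedWeight b ξ ^ 2 := sq_sum_le_card_mul_sum_sq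
      _ ≤ _ := by gcongr
  rw [neg_div, Real.rpow_neg hn0.le, ← div_eq_mul_inv, div_le_iff₀ (by positivity)]
  calc (1 / 72 : ℝ) ≤ (3 / 20) ^ 2 := by norm_num
    _ ≤ _ := hcs
    _ = _ := by ring
end
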